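/- arXiv:2001.04005 — 8 statements merged into one kernel-verified Lean document; each statement's English description precedes it below -/
import Mathlib

section
/- (Claim 1) If μ* is an optimal solution (a feasible vector minimizing c) and ĉ* = c(μ*), then for every n ∈ [N] either μ*[n] = ĉ*·s[n], or μ*[n] = 1 and 1 < ĉ*·s[n]. -/
open Finset

/-- Claim 1: If `μ*` is an optimal solution and `ĉ* = c(μ*)`,
then for every `n ∈ [N]` either `μ*[n] = ĉ*·s[n]`, or `μ*[n] = 1` and
`1 < ĉ*·s[n]`. -/
theorem stmt_2 (N L : ℕ) (hL : 1 ≤ L) (hLN : L ≤ N) (s : ℕ → ℝ)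
    (hs : ∀ n ∈ Icc 1 N, 0 < s n) (μ : ℕ → ℝ)
    (hfeas : (∑ n ∈ Icc 1 N, μ n) = L ∧ ∀ n ∈ Icc 1 N, 0 ≤ μ n ∧ μ n ≤ 1)
    (hopt : ∀ ν : ℕ → ℝ,
      ((∑ n ∈ Icc 1 N, ν n) = L ∧ ∀ n ∈ Icc 1 N, 0 ≤ ν n ∧ ν n ≤ 1) →
      (Icc 1 N).sup' (nonempty_Icc.mpr (hL.trans hLN)) (fun n => μ n / s n) ≤
        (Icc 1 N).sup' (nonempty_Icc.mpr (hL.trans hLN)) (fun n => ν n / s n))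
    (c : ℝ)
    (hc : c = (Icc 1 N).sup' (nonempty_Icc.mpr (hL.trans hLN)) (fun n => μ n / s n)) :
    ∀ n ∈ Icc 1 N, μ n = c * s n ∨ (μ n = 1 ∧ 1 < c * s n) := by
  have le_mul : ∀ m ∈ Icc 1 N, μ m ≤ c * s m := fun m hm => by
    rw [← div_le_iff₀ (hs m hm), hc]
    exact le_sup' (fun n => μ n / s n) hm
  intro n hn
  by_contra! hcon
  have hlt : μ n < c * s n := lt_of_le_of_ne (le_mul n hn) hcon.1
  have hlt_one : μ n < 1 := lt_of_le_of_ne (hfeas.2 n hn).2 fun h =>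
    (hcon.2 h).not_gt (h ▸ hlt)
  have hc_pos : 0 < c :=
    pos_of_mul_pos_left ((hfeas.2 n hn).1.trans_lt hlt) (hs n hn).le
  -- Rescaling the truncated loads `min 1 (c * s m)` to total `L` strictly lowers the time.
  set G := ∑ m ∈ Icc 1 N, min 1 (c * s m) with hG
  have hLG : (L : ℝ) < G := by
    rw [← hfeas.1]
    exact sum_lt_sum (fun m hm => le_min (hfeas.2 m hm).2 (le_mul m hm))
      ⟨n, hn, lt_min hlt_one hlt⟩
  have hG_pos : 0 < G := (Nat.cast_nonneg L).trans_lt hLG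
  have ht_nonneg : 0 ≤ L / G := by positivity
  have ht_lt : L / G < 1 := (div_lt_one hG_pos).mpr hLG
  have hle := hopt (fun m => L / G * min 1 (c * s m)) ⟨by
      rw [← mul_sum, ← hG, div_mul_cancel₀ _ hG_pos.ne'], fun m hm =>
      ⟨mul_nonneg ht_nonneg (le_min zero_le_one (mul_pos hc_pos (hs m hm)).le),
        (mul_le_of_le_one_right ht_nonneg (min_le_left _ _)).trans ht_lt.le⟩⟩
  rw [← hc] at hle
  refine hle.not_gt ((sup'_lt_iff _).mpr fun m hm => ?_)
  rw [div_lt_iff₀ (hs m hm)]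
  calc L / G * min 1 (c * s m) ≤ L / G * (c * s m) :=
        mul_le_mul_of_nonneg_left (min_le_right _ _) ht_nonneg
    _ < c * s m := mul_lt_of_lt_one_left (mul_pos hc_pos (hs m hm)) ht_lt
end

section
/- (Claim 2) Let μ* be an optimal solution with ĉ* = c(μ*), and set T₀ = {n ∈ [N] : μ*[n] = ĉ*·s[n]} and T₁ = {n ∈ [N] : μ*[n] < ĉ*·s[n]}, where every n ∈ T₁ satisfies μ*[n] = 1. Then for every j ∈ T₀ and every i ∈ T₁ one has s[j] < s[i]. -/
open Finset

/-- Claim 2: Let `μ*` be optimal with `ĉ* = c(μ*)`, and let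
`T₀ = {n : μ*[n] = ĉ*·s[n]}`, `T₁ = {n : μ*[n] < ĉ*·s[n]}`, where every
`n ∈ T₁` satisfies `μ*[n] = 1`. Then for every `j ∈ T₀` and `i ∈ T₁`,
`s[j] < s[i]`. -/
theorem stmt_3 (N L : ℕ) (hL : 1 ≤ L) (hLN : L ≤ N) (s : ℕ → ℝ)
    (hs : ∀ n ∈ Icc 1 N, 0 < s n) (μ : ℕ → ℝ)
    (hfeas : (∑ n ∈ Icc 1 N, μ n) = L ∧ ∀ n ∈ Icc 1 N, 0 ≤ μ n ∧ μ n ≤ 1)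
    (hopt : ∀ ν : ℕ → ℝ,
      ((∑ n ∈ Icc 1 N, ν n) = L ∧ ∀ n ∈ Icc 1 N, 0 ≤ ν n ∧ ν n ≤ 1) →
      (Icc 1 N).sup' (nonempty_Icc.mpr (hL.trans hLN)) (fun n => μ n / s n) ≤
        (Icc 1 N).sup' (nonempty_Icc.mpr (hL.trans hLN)) (fun n => ν n / s n))
    (c : ℝ)
    (hc : c = (Icc 1 N).sup' (nonempty_Icc.mpr (hL.trans hLN)) (fun n => μ n / s n))
    (hT1 : ∀ n ∈ Icc 1 N, μ n < c * s n → μ n = 1) :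
    ∀ j ∈ Icc 1 N, ∀ i ∈ Icc 1 N,
      μ j = c * s j → μ i < c * s i → s j < s i := by
  intro j hj i hi hμj hμi
  have hlt : c * s j < c * s i := by
    linarith [hT1 i hi hμi, (hfeas.2 j hj).2]
  have hc_pos : 0 < c :=
    pos_of_mul_pos_left (((hfeas.2 i hi).1).trans_lt hμi) (hs i hi).le
  exact lt_of_mul_lt_mul_left hlt hc_pos.le
end

section
/- Every optimal solution has threshold form: assume N > L and s[1] ≤ s[2] ≤ ⋯ ≤ s[N]. If μ* is an optimal solution with ĉ* = c(μ*), then there exists an integer k ∈ [0, N] such that μ*[n] = ĉ*·s[n] for all 1 ≤ n ≤ k and μ*[n] = 1 for all k+1 ≤ n ≤ N. -/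
open Finset

/-- A load vector below a cap vector `m` with `m ≤ 1` and `m ≤ c * s` which is strictly below `m`
somewhere can be replaced by a rescaling of `m` with computation time less than `c`. -/
theorem exists_rescaled_load_lt {ι : Type*} {t : Finset ι} {s μ m : ι → ℝ} {c : ℝ}
    (hs : ∀ n ∈ t, 0 < s n) (hc : 0 < c) (hμ0 : ∀ n ∈ t, 0 ≤ μ n) (hμm : ∀ n ∈ t, μ n ≤ m n)
    (hm1 : ∀ n ∈ t, m n ≤ 1) (hmc : ∀ n ∈ t, m n ≤ c * s n) (hlt : ∃ n ∈ t, μ n < m n) :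
    ∃ ν : ι → ℝ, ∑ n ∈ t, ν n = ∑ n ∈ t, μ n ∧ (∀ n ∈ t, 0 ≤ ν n ∧ ν n ≤ 1) ∧
      ∀ n ∈ t, ν n / s n < c := by
  have hsum : ∑ n ∈ t, μ n < ∑ n ∈ t, m n := sum_lt_sum hμm hlt
  have hsum0 : 0 ≤ ∑ n ∈ t, μ n := sum_nonneg hμ0
  have hM : 0 < ∑ n ∈ t, m n := hsum0.trans_lt hsum
  set r := (∑ n ∈ t, μ n) / ∑ n ∈ t, m n with hr
  have hr0 : 0 ≤ r := div_nonneg hsum0 hM.le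
  have hr1 : r < 1 := (div_lt_one hM).2 hsum
  refine ⟨fun n => r * m n, ?_, fun n hn => ⟨?_, ?_⟩, fun n hn => ?_⟩
  · rw [← mul_sum, hr, div_mul_cancel₀ _ hM.ne']
  · exact mul_nonneg hr0 ((hμ0 n hn).trans (hμm n hn))
  · exact mul_le_one₀ hr1.le ((hμ0 n hn).trans (hμm n hn)) (hm1 n hn)
  · rw [div_lt_iff₀ (hs n hn)]
    calc r * m n ≤ r * (c * s n) := mul_le_mul_of_nonneg_left (hmc n hn) hr0
      _ < c * s n := mul_lt_of_lt_one_left (mul_pos hc (hs n hn)) hr1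

/-- Every optimal solution has threshold form: if `N > L`,
`s[1] ≤ ⋯ ≤ s[N]`, and `μ*` is optimal with `ĉ* = c(μ*)`, then there is an
integer `k ∈ [0, N]` with `μ*[n] = ĉ*·s[n]` for `1 ≤ n ≤ k` and
`μ*[n] = 1` for `k+1 ≤ n ≤ N`. -/
theorem stmt_4 (N L : ℕ) (hL : 1 ≤ L) (hLN : L < N) (s : ℕ → ℝ)
    (hs : ∀ n ∈ Icc 1 N, 0 < s n)
    (hmono : ∀ m ∈ Icc 1 N, ∀ n ∈ Icc 1 N, m ≤ n → s m ≤ s n)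
    (μ : ℕ → ℝ)
    (hfeas : (∑ n ∈ Icc 1 N, μ n) = L ∧ ∀ n ∈ Icc 1 N, 0 ≤ μ n ∧ μ n ≤ 1)
    (hopt : ∀ ν : ℕ → ℝ,
      ((∑ n ∈ Icc 1 N, ν n) = L ∧ ∀ n ∈ Icc 1 N, 0 ≤ ν n ∧ ν n ≤ 1) →
      (Icc 1 N).sup' (nonempty_Icc.mpr (hL.trans hLN.le)) (fun n => μ n / s n) ≤
        (Icc 1 N).sup' (nonempty_Icc.mpr (hL.trans hLN.le)) (fun n => ν n / s n))
    (c : ℝ)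
    (hc : c = (Icc 1 N).sup' (nonempty_Icc.mpr (hL.trans hLN.le)) (fun n => μ n / s n)) :
    ∃ k : ℕ, k ≤ N ∧
      (∀ n, 1 ≤ n → n ≤ k → μ n = c * s n) ∧
      (∀ n, k + 1 ≤ n → n ≤ N → μ n = 1) := by
  obtain ⟨hsum, hbd⟩ := hfeas
  have hle : ∀ n ∈ Icc 1 N, μ n ≤ c * s n := fun n hn => by
    rw [← div_le_iff₀ (hs n hn), hc]
    exact le_sup' (fun n => μ n / s n) hn
  have hc0 : 0 < c := by
    by_contra! h
    have h0 : ∑ n ∈ Icc 1 N, μ n ≤ 0 := sum_nonpos fun n hn =>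
      (hle n hn).trans (mul_nonpos_of_nonpos_of_nonneg h (hs n hn).le)
    have hL' : (1 : ℝ) ≤ L := by exact_mod_cast hL
    linarith
  have hmin : ∀ n ∈ Icc 1 N, μ n = min 1 (c * s n) := by
    by_contra! ⟨j, hj, hne⟩
    have hμm : ∀ n ∈ Icc 1 N, μ n ≤ min 1 (c * s n) := fun n hn =>
      le_min (hbd n hn).2 (hle n hn)
    obtain ⟨ν, hνsum, hνbd, hνc⟩ := exists_rescaled_load_lt hs hc0 (fun n hn => (hbd n hn).1) hμm
      (fun n _ => min_le_left _ _) (fun n _ => min_le_right _ _)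
      ⟨j, hj, lt_of_le_of_ne (hμm j hj) hne⟩
    have h := hopt ν ⟨hνsum.trans hsum, hνbd⟩
    rw [← hc] at h
    exact h.not_gt ((sup'_lt_iff _).2 hνc)
  refine ⟨Nat.findGreatest (fun n => c * s n ≤ 1) N, Nat.findGreatest_le N,
    fun n h1 hn => ?_, fun n hn hN => ?_⟩
  · have hk := Nat.findGreatest_of_ne_zero (P := fun n => c * s n ≤ 1) (n := N) rfl (by omega)
    have hkN := Nat.findGreatest_le (P := fun n => c * s n ≤ 1) N
    have hnI : n ∈ Icc 1 N := mem_Icc.2 ⟨h1, hn.trans hkN⟩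
    rw [hmin n hnI]
    refine min_eq_right (le_trans ?_ hk)
    exact mul_le_mul_of_nonneg_left
      (hmono n hnI _ (mem_Icc.2 ⟨h1.trans hn, hkN⟩) hn) hc0.le
  · have hk : ¬ c * s n ≤ 1 := Nat.findGreatest_is_greatest (P := fun n => c * s n ≤ 1) hn hN
    rw [hmin n (mem_Icc.2 ⟨by omega, hN⟩)]
    exact min_eq_left (not_le.1 hk).le
end

section
/- Feasibility and value of the candidate solution: assume N > L, 0 < s[1] ≤ ⋯ ≤ s[N], and let k ∈ [N−L+1, N] satisfy condition (13), i.e., ĉ_k ≤ 1/s[k] and, when k < N, also 1/s[k+1] < ĉ_k, where ĉ_k = (k+L−N)/Σ_{n=1}^k s[n]. Define μ by μ[n] = ĉ_k·s[n] for 1 ≤ n ≤ k and μ[n] = 1 for k+1 ≤ n ≤ N. Then μ is feasible (Σ_{n=1}^N μ[n] = L and 0 < μ[n] ≤ 1 for all n), and c(μ) = max_{n∈[N]} μ[n]/s[n] = ĉ_k. -/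
open Finset

/-- Feasibility and value of the candidate solution: assume
`N > L`, `0 < s[1] ≤ ⋯ ≤ s[N]`, and let `k ∈ [N−L+1, N]` satisfy
`ĉ_k ≤ 1/s[k]` and (when `k < N`) `1/s[k+1] < ĉ_k`, where
`ĉ_k = (k+L−N)/Σ_{n=1}^k s[n]`. Define `μ[n] = ĉ_k·s[n]` for `1 ≤ n ≤ k`
and `μ[n] = 1` for `k+1 ≤ n ≤ N`. Then `μ` is feasible
(`Σ μ[n] = L` and `0 < μ[n] ≤ 1` for all `n ∈ [N]`) and
`c(μ) = max_{n∈[N]} μ[n]/s[n] = ĉ_k`. -/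
theorem stmt_5 (N L : ℕ) (hL : 1 ≤ L) (hLN : L < N) (s : ℕ → ℝ)
    (hs : ∀ n ∈ Icc 1 N, 0 < s n)
    (hmono : ∀ m ∈ Icc 1 N, ∀ n ∈ Icc 1 N, m ≤ n → s m ≤ s n)
    (k : ℕ) (hk1 : N - L + 1 ≤ k) (hk2 : k ≤ N)
    (c : ℝ) (hc : c = ((k : ℝ) + L - N) / ∑ n ∈ Icc 1 k, s n)
    (hrhs : c ≤ 1 / s k)
    (hlhs : k < N → 1 / s (k + 1) < c)
    (μ : ℕ → ℝ)
    (hμ : ∀ n ∈ Icc 1 N, μ n = if n ≤ k then c * s n else 1) :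
    ((∑ n ∈ Icc 1 N, μ n) = L ∧ ∀ n ∈ Icc 1 N, 0 < μ n ∧ μ n ≤ 1) ∧
    (Icc 1 N).sup' (nonempty_Icc.mpr (hL.trans hLN.le)) (fun n => μ n / s n) = c := by
  have hk0 : 1 ≤ k := by omega
  have hN : 1 ≤ N := by omega
  have hnum : (0 : ℝ) < (k : ℝ) + L - N := by
    have h : N < k + L := by omega
    have h' : (N : ℝ) < k + L := by exact_mod_cast h
    linarith
  have hsum : 0 < ∑ n ∈ Icc 1 k, s n := by
    refine sum_pos (fun n hn => hs n ?_) (nonempty_Icc.mpr hk0)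
    exact Icc_subset_Icc_right hk2 hn
  have hcpos : 0 < c := hc ▸ div_pos hnum hsum
  have hkmem : k ∈ Icc 1 N := mem_Icc.mpr ⟨hk0, hk2⟩
  refine ⟨⟨?_, fun n hn => ?_⟩, ?_⟩
  · have hle : (Icc 1 N).filter (fun n => n ≤ k) = Icc 1 k := by
      ext n
      simp only [mem_filter, mem_Icc]
      omega
    have hgt : (Icc 1 N).filter (fun n => ¬ n ≤ k) = Icc (k + 1) N := by
      ext n
      simp only [mem_filter, mem_Icc]
      omega
    rw [sum_congr rfl hμ, sum_ite, hle, hgt, ← mul_sum, hc, div_mul_cancel₀ _ hsum.ne',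
      sum_const, Nat.card_Icc, Nat.add_sub_add_right, nsmul_eq_mul, Nat.cast_sub hk2]
    ring
  · rw [hμ n hn]
    split_ifs with h
    · refine ⟨mul_pos hcpos (hs n hn), ?_⟩
      calc c * s n ≤ c * s k :=
            mul_le_mul_of_nonneg_left (hmono n hn k hkmem h) hcpos.le
        _ ≤ 1 := (le_div_iff₀ (hs k hkmem)).mp hrhs
    · exact ⟨one_pos, le_rfl⟩
  · apply le_antisymm
    · refine sup'_le _ _ fun n hn => ?_
      rw [hμ n hn]
      split_ifs with h
      · exact (mul_div_cancel_right₀ c (hs n hn).ne').le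
      · have hnN := (mem_Icc.mp hn).2
        have hk1mem : k + 1 ∈ Icc 1 N := mem_Icc.mpr ⟨by omega, by omega⟩
        exact (one_div_le_one_div_of_le (hs _ hk1mem)
          (hmono _ hk1mem n hn (by omega))).trans (hlhs (by omega)).le
    · have h1 : 1 ∈ Icc 1 N := mem_Icc.mpr ⟨le_rfl, hN⟩
      refine le_sup'_of_le _ h1 ?_
      rw [hμ 1 h1, if_pos hk0, mul_div_cancel_right₀ c (hs 1 h1).ne']
end

section
/- Optimality lower bound: assume N > L, 0 < s[1] ≤ ⋯ ≤ s[N], and let k ∈ [N−L+1, N] satisfy ĉ_k ≤ 1/s[k] and, when k < N, 1/s[k+1] < ĉ_k, where ĉ_k = (k+L−N)/Σ_{n=1}^k s[n]. Then every feasible computation load vector μ satisfies max_{n∈[N]} μ[n]/s[n] ≥ ĉ_k; consequently the minimum computation time over all feasible vectors equals ĉ_k. -/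
open Finset

theorem sum_Icc_one_eq_add_sum_Ioc {k N : ℕ} (h : k ≤ N) (f : ℕ → ℝ) :
    ∑ n ∈ Icc 1 N, f n = ∑ n ∈ Icc 1 k, f n + ∑ n ∈ Ioc k N, f n :=
  (Finset.sum_Ioc_consecutive f (Nat.zero_le k) h).symm

/-- Optimality lower bound: assume `N > L`,
`0 < s[1] ≤ ⋯ ≤ s[N]`, and let `k ∈ [N−L+1, N]` satisfy `ĉ_k ≤ 1/s[k]` and
(when `k < N`) `1/s[k+1] < ĉ_k`, where `ĉ_k = (k+L−N)/Σ_{n=1}^k s[n]`.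
Then every feasible `μ` satisfies `max_{n∈[N]} μ[n]/s[n] ≥ ĉ_k`;
consequently the minimum computation time over all feasible vectors
equals `ĉ_k`. -/
theorem stmt_6 (N L : ℕ) (hL : 1 ≤ L) (hLN : L < N) (s : ℕ → ℝ)
    (hs : ∀ n ∈ Icc 1 N, 0 < s n)
    (hmono : ∀ m ∈ Icc 1 N, ∀ n ∈ Icc 1 N, m ≤ n → s m ≤ s n)
    (k : ℕ) (hk1 : N - L + 1 ≤ k) (hk2 : k ≤ N)
    (c : ℝ) (hc : c = ((k : ℝ) + L - N) / ∑ n ∈ Icc 1 k, s n)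
    (hrhs : c ≤ 1 / s k)
    (hlhs : k < N → 1 / s (k + 1) < c) :
    (∀ μ : ℕ → ℝ,
      ((∑ n ∈ Icc 1 N, μ n) = L ∧ ∀ n ∈ Icc 1 N, 0 ≤ μ n ∧ μ n ≤ 1) →
      c ≤ (Icc 1 N).sup' (nonempty_Icc.mpr (hL.trans hLN.le)) (fun n => μ n / s n)) ∧
    IsLeast {t : ℝ | ∃ μ : ℕ → ℝ,
      ((∑ n ∈ Icc 1 N, μ n) = L ∧ ∀ n ∈ Icc 1 N, 0 ≤ μ n ∧ μ n ≤ 1) ∧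
      (Icc 1 N).sup' (nonempty_Icc.mpr (hL.trans hLN.le)) (fun n => μ n / s n) = t} c := by
  have hN : (Icc 1 N).Nonempty := nonempty_Icc.mpr (hL.trans hLN.le)
  have hk : k ∈ Icc 1 N := mem_Icc.mpr ⟨by omega, hk2⟩
  have hsub : ∀ n ∈ Icc 1 k, n ∈ Icc 1 N := fun n hn => Icc_subset_Icc_right hk2 hn
  have hS : 0 < ∑ n ∈ Icc 1 k, s n :=
    sum_pos (fun n hn => hs n (hsub n hn)) (nonempty_Icc.mpr (by omega))
  have hnum : (0 : ℝ) < (k : ℝ) + L - N := by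
    have h : (N : ℝ) + 1 ≤ k + L := by exact_mod_cast (by omega : N + 1 ≤ k + L)
    linarith
  have hc0 : 0 < c := hc ▸ div_pos hnum hS
  have hcS : c * ∑ n ∈ Icc 1 k, s n = (k : ℝ) + L - N := by
    rw [hc, div_mul_cancel₀ _ hS.ne']
  have hcard : ∑ _n ∈ Ioc k N, (1 : ℝ) = (N : ℝ) - k := by
    simp [Nat.cast_sub hk2]
  have hlower : ∀ μ : ℕ → ℝ,
      ((∑ n ∈ Icc 1 N, μ n) = L ∧ ∀ n ∈ Icc 1 N, 0 ≤ μ n ∧ μ n ≤ 1) →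
      c ≤ (Icc 1 N).sup' hN (fun n => μ n / s n) := by
    rintro μ ⟨hsum, hμ⟩
    set t := (Icc 1 N).sup' hN (fun n => μ n / s n)
    have hfast : ∑ n ∈ Ioc k N, μ n ≤ ∑ _n ∈ Ioc k N, (1 : ℝ) :=
      sum_le_sum fun n hn => (hμ n (by simp only [mem_Ioc, mem_Icc] at *; omega)).2
    have hslow : ∑ n ∈ Icc 1 k, μ n ≤ t * ∑ n ∈ Icc 1 k, s n := by
      rw [mul_sum]
      exact sum_le_sum fun n hn => (div_le_iff₀ (hs n (hsub n hn))).mp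
        (le_sup' (fun n => μ n / s n) (hsub n hn))
    rw [sum_Icc_one_eq_add_sum_Ioc hk2] at hsum
    rw [hc, div_le_iff₀ hS]
    linarith
  refine ⟨hlower, ?_, ?_⟩
  · let μ : ℕ → ℝ := fun n => if n ≤ k then c * s n else 1
    have hfeas : (∑ n ∈ Icc 1 N, μ n) = L ∧ ∀ n ∈ Icc 1 N, 0 ≤ μ n ∧ μ n ≤ 1 := by
      constructor
      · have hslow : ∑ n ∈ Icc 1 k, μ n = c * ∑ n ∈ Icc 1 k, s n := by
          rw [mul_sum]
          exact sum_congr rfl fun n hn => if_pos (mem_Icc.mp hn).2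
        have hfast : ∑ n ∈ Ioc k N, μ n = ∑ _n ∈ Ioc k N, (1 : ℝ) :=
          sum_congr rfl fun n hn => if_neg (not_le.mpr (mem_Ioc.mp hn).1)
        rw [sum_Icc_one_eq_add_sum_Ioc hk2, hslow, hfast, hcS, hcard]
        ring
      · intro n hn
        by_cases hnk : n ≤ k
        · simp only [μ, if_pos hnk]
          exact ⟨(mul_pos hc0 (hs n hn)).le,
            (mul_le_mul_of_nonneg_left (hmono n hn k hk hnk) hc0.le).trans
              ((le_div_iff₀ (hs k hk)).mp hrhs)⟩
        · simp [μ, if_neg hnk]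
    refine ⟨μ, hfeas, le_antisymm (sup'_le _ _ fun n hn => ?_) (hlower μ hfeas)⟩
    by_cases hnk : n ≤ k
    · simp only [μ, if_pos hnk]
      exact (mul_div_cancel_right₀ c (hs n hn).ne').le
    · have hnN := (mem_Icc.mp hn).2
      have hk' : k + 1 ∈ Icc 1 N := mem_Icc.mpr ⟨by omega, by omega⟩
      simp only [μ, if_neg hnk]
      exact (one_div_le_one_div_of_le (hs _ hk') (hmono _ hk' n hn (by omega))).trans
        (hlhs (by omega)).le
  · rintro t ⟨μ, hμ, rfl⟩
    exact hlower μ hμ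
end

section
/- (Theorem 1) Assume N > L and 0 < s[1] ≤ s[2] ≤ ⋯ ≤ s[N]. Let k* be the largest integer in [N−L+1, N] such that ĉ_{k*} ≤ 1/s[k*] and, when k* < N, 1/s[k*+1] < ĉ_{k*}, where ĉ_k = (k+L−N)/Σ_{n=1}^k s[n]. Then every optimal solution μ* of the problem min{ max_{n∈[N]} μ[n]/s[n] : Σ_{n=1}^N μ[n] = L, 0 ≤ μ[n] ≤ 1 } satisfies μ*[n] = ĉ_{k*}·s[n] for 1 ≤ n ≤ k* and μ*[n] = 1 for k*+1 ≤ n ≤ N, and the optimal value of the problem is c(μ*) = ĉ_{k*}. -/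
open Finset

/-- The load vector that runs the first `k` machines for time `c` and loads the others fully. -/
noncomputable def thresholdLoad (s : ℕ → ℝ) (c : ℝ) (k n : ℕ) : ℝ :=
  if n ≤ k then c * s n else 1

lemma sum_thresholdLoad (s : ℕ → ℝ) (c : ℝ) {k N : ℕ} (hk : k ≤ N) :
    ∑ n ∈ Icc 1 N, thresholdLoad s c k n = c * (∑ n ∈ Icc 1 k, s n) + ((N : ℝ) - k) := by
  induction N, hk using Nat.le_induction with
  | base =>
    rw [mul_sum, sub_self, add_zero]
    exact sum_congr rfl fun n hn => if_pos (mem_Icc.mp hn).2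
  | succ N hN ih =>
    rw [sum_Icc_succ_top (by omega), ih, thresholdLoad, if_neg (by omega)]
    push_cast
    ring

/-- Theorem 1: Assume `N > L` and `0 < s[1] ≤ ⋯ ≤ s[N]`.
Let `k*` be the largest integer in `[N−L+1, N]` such that
`ĉ_{k*} ≤ 1/s[k*]` and (when `k* < N`) `1/s[k*+1] < ĉ_{k*}`, where
`ĉ_k = (k+L−N)/Σ_{n=1}^k s[n]`. Then every optimal solution `μ*`
satisfies `μ*[n] = ĉ_{k*}·s[n]` for `1 ≤ n ≤ k*` and `μ*[n] = 1` for
`k*+1 ≤ n ≤ N`, and the optimal value is `c(μ*) = ĉ_{k*}`. -/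
theorem stmt_7 (N L : ℕ) (hL : 1 ≤ L) (hLN : L < N) (s : ℕ → ℝ)
    (hs : ∀ n ∈ Icc 1 N, 0 < s n)
    (hmono : ∀ m ∈ Icc 1 N, ∀ n ∈ Icc 1 N, m ≤ n → s m ≤ s n)
    (kstar : ℕ) (hk1 : N - L + 1 ≤ kstar) (hk2 : kstar ≤ N)
    (hcond : ((kstar : ℝ) + L - N) / (∑ n ∈ Icc 1 kstar, s n) ≤ 1 / s kstar ∧
      (kstar < N →
        1 / s (kstar + 1) < ((kstar : ℝ) + L - N) / (∑ n ∈ Icc 1 kstar, s n)))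
    (hmax : ∀ k : ℕ, N - L + 1 ≤ k → k ≤ N →
      (((k : ℝ) + L - N) / (∑ n ∈ Icc 1 k, s n) ≤ 1 / s k ∧
        (k < N → 1 / s (k + 1) < ((k : ℝ) + L - N) / (∑ n ∈ Icc 1 k, s n))) →
      k ≤ kstar)
    (μ : ℕ → ℝ)
    (hfeas : (∑ n ∈ Icc 1 N, μ n) = L ∧ ∀ n ∈ Icc 1 N, 0 ≤ μ n ∧ μ n ≤ 1)
    (hopt : ∀ ν : ℕ → ℝ,
      ((∑ n ∈ Icc 1 N, ν n) = L ∧ ∀ n ∈ Icc 1 N, 0 ≤ ν n ∧ ν n ≤ 1) →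
      (Icc 1 N).sup' (nonempty_Icc.mpr (hL.trans hLN.le)) (fun n => μ n / s n) ≤
        (Icc 1 N).sup' (nonempty_Icc.mpr (hL.trans hLN.le)) (fun n => ν n / s n)) :
    (∀ n, 1 ≤ n → n ≤ kstar →
        μ n = (((kstar : ℝ) + L - N) / (∑ n ∈ Icc 1 kstar, s n)) * s n) ∧
    (∀ n, kstar + 1 ≤ n → n ≤ N → μ n = 1) ∧
    (Icc 1 N).sup' (nonempty_Icc.mpr (hL.trans hLN.le)) (fun n => μ n / s n) =
      ((kstar : ℝ) + L - N) / (∑ n ∈ Icc 1 kstar, s n) := by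
  have hk : 1 ≤ kstar := by omega
  have hS : 0 < ∑ n ∈ Icc 1 kstar, s n :=
    sum_pos (fun n hn => hs n (Icc_subset_Icc_right hk2 hn)) (nonempty_Icc.mpr hk)
  have hnum : (0 : ℝ) < (kstar : ℝ) + L - N := by
    have : (N : ℝ) < kstar + L := by exact_mod_cast (by omega : N < kstar + L)
    linarith
  obtain ⟨hle, hlt⟩ := hcond
  set c := ((kstar : ℝ) + L - N) / (∑ n ∈ Icc 1 kstar, s n) with hc
  have hc0 : 0 < c := div_pos hnum hS
  have hsum : ∑ n ∈ Icc 1 N, thresholdLoad s c kstar n = L := by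
    rw [sum_thresholdLoad s c hk2, hc, div_mul_cancel₀ _ hS.ne']
    ring
  have hbounds : ∀ n ∈ Icc 1 N,
      0 ≤ thresholdLoad s c kstar n ∧ thresholdLoad s c kstar n ≤ 1 := by
    intro n hn
    unfold thresholdLoad
    split_ifs with h
    · have hkN : kstar ∈ Icc 1 N := mem_Icc.mpr ⟨hk, hk2⟩
      exact ⟨(mul_pos hc0 (hs n hn)).le,
        (mul_le_mul_of_nonneg_left (hmono n hn kstar hkN h) hc0.le).trans
          ((le_div_iff₀ (hs kstar hkN)).mp hle)⟩
    · exact ⟨zero_le_one, le_rfl⟩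
  have htime : ∀ n ∈ Icc 1 N, thresholdLoad s c kstar n / s n ≤ c := by
    intro n hn
    unfold thresholdLoad
    split_ifs with h
    · rw [mul_div_cancel_right₀ _ (hs n hn).ne']
    · have hnN := (mem_Icc.mp hn).2
      have hk' : kstar + 1 ∈ Icc 1 N := mem_Icc.mpr ⟨by omega, by omega⟩
      exact (one_div_le_one_div_of_le (hs _ hk') (hmono _ hk' n hn (by omega))).trans
        (hlt (by omega)).le
  have hsup := (hopt _ ⟨hsum, hbounds⟩).trans (sup'_le _ _ htime)
  have hμle : ∀ n ∈ Icc 1 N, μ n ≤ thresholdLoad s c kstar n := by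
    intro n hn
    unfold thresholdLoad
    split_ifs with h
    · exact (div_le_iff₀ (hs n hn)).mp ((sup'_le_iff _ _).mp hsup n hn)
    · exact (hfeas.2 n hn).2
  have hμ := (sum_eq_sum_iff_of_le hμle).mp (hfeas.1.trans hsum.symm)
  have hμlow : ∀ n, 1 ≤ n → n ≤ kstar → μ n = c * s n := fun n h1 h2 =>
    (hμ n (mem_Icc.mpr ⟨h1, h2.trans hk2⟩)).trans (if_pos h2)
  refine ⟨hμlow, fun n h1 h2 => (hμ n (mem_Icc.mpr ⟨by omega, h2⟩)).trans (if_neg (by omega)),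
    le_antisymm hsup ?_⟩
  have h1N : 1 ∈ Icc 1 N := mem_Icc.mpr ⟨le_rfl, hk.trans hk2⟩
  calc c = μ 1 / s 1 := by rw [hμlow 1 le_rfl hk, mul_div_cancel_right₀ _ (hs 1 h1N).ne']
    _ ≤ _ := le_sup' (fun n => μ n / s n) h1N
end

section
/- Cascade property of condition (13): assume N > L and 0 < s[1] ≤ s[2] ≤ ⋯ ≤ s[N]. For every integer i with N−L+2 ≤ i ≤ N, if ĉ_i > 1/s[i] then 1/s[i] < ĉ_{i−1}, where ĉ_k = (k+L−N)/Σ_{n=1}^k s[n]. -/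
open Finset

/-- Cascade property of condition (13): assume `N > L` and
`0 < s[1] ≤ ⋯ ≤ s[N]`. For every integer `i` with `N−L+2 ≤ i ≤ N`, if
`ĉ_i > 1/s[i]` then `1/s[i] < ĉ_{i−1}`, where
`ĉ_k = (k+L−N)/Σ_{n=1}^k s[n]`. -/
theorem stmt_8 (N L : ℕ) (hL : 1 ≤ L) (hLN : L < N) (s : ℕ → ℝ)
    (hs : ∀ n ∈ Icc 1 N, 0 < s n)
    (hmono : ∀ m ∈ Icc 1 N, ∀ n ∈ Icc 1 N, m ≤ n → s m ≤ s n) :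
    ∀ i : ℕ, N - L + 2 ≤ i → i ≤ N →
      1 / s i < ((i : ℝ) + L - N) / (∑ n ∈ Icc 1 i, s n) →
      1 / s i < (((i : ℝ) - 1) + L - N) / (∑ n ∈ Icc 1 (i - 1), s n) := by
  intro i hi hiN h
  obtain ⟨k, rfl⟩ : ∃ k, i = k + 1 := ⟨i - 1, by omega⟩
  have hsi : 0 < s (k + 1) := hs _ (by simp; omega)
  have hsum : 0 < ∑ n ∈ Icc 1 k, s n :=
    sum_pos (fun n hn => hs n (by simp at hn ⊢; omega)) ⟨1, by simp; omega⟩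
  rw [sum_Icc_succ_top (by omega), div_lt_div_iff₀ hsi (by positivity)] at h
  rw [Nat.add_sub_cancel, div_lt_div_iff₀ hsi hsum]
  linarith
end

section
/- Existence of a computation assignment realizing a computation load vector (filling problem, sufficiency with at most N parts): let N ≥ L ≥ 1 be integers and let μ ∈ ℝ^N satisfy 0 ≤ μ[n] ≤ 1 for all n ∈ [N] and Σ_{n=1}^N μ[n] = L. Then there exist an integer F with 1 ≤ F ≤ N, positive reals α_1, …, α_F with Σ_{f=1}^F α_f = 1, and subsets P_1, …, P_F ⊆ [N] each of cardinality exactly L, such that for every n ∈ [N], Σ_{f : n ∈ P_f} α_f = μ[n]. -/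
open Finset

open Classical in
/-- The coordinates of a load vector `x` on `s` lying strictly between the extreme values `0` and
the total `T`. -/
noncomputable def fractionalPart {ι : Type*} (s : Finset ι) (x : ι → ℝ) (T : ℝ) : Finset ι :=
  s.filter fun i => x i ≠ 0 ∧ x i ≠ T

lemma mem_fractionalPart {ι : Type*} {s : Finset ι} {x : ι → ℝ} {T : ℝ} {i : ι} :
    i ∈ fractionalPart s x T ↔ i ∈ s ∧ x i ≠ 0 ∧ x i ≠ T := by
  simp [fractionalPart]

/-- A set of size `L` containing all coordinates that are full and none that are empty. -/
lemma exists_card_eq_of_sum_eq {ι : Type*} [DecidableEq ι] {s : Finset ι} {L : ℕ} {x : ι → ℝ}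
    {T : ℝ} (hT : 0 < T) (hx : ∀ i ∈ s, 0 ≤ x i ∧ x i ≤ T) (hsum : ∑ i ∈ s, x i = L * T) :
    ∃ P ⊆ s, P.card = L ∧ (∀ i ∈ P, x i ≠ 0) ∧ ∀ i ∈ s, i ∉ P → x i ≠ T := by
  have hAB : s.filter (fun i => x i = T) ⊆ s.filter (fun i => x i ≠ 0) := by
    intro i
    simp only [mem_filter]
    rintro ⟨hi, h⟩
    exact ⟨hi, h ▸ hT.ne'⟩
  have hA : (s.filter (fun i => x i = T)).card ≤ L := by
    have h : ∑ i ∈ s.filter (fun i => x i = T), x i ≤ ∑ i ∈ s, x i :=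
      sum_le_sum_of_subset_of_nonneg (filter_subset _ _) fun i hi _ => (hx i hi).1
    rw [sum_congr rfl (g := fun _ => T) (fun i hi => (mem_filter.1 hi).2), sum_const,
      nsmul_eq_mul, hsum] at h
    exact_mod_cast le_of_mul_le_mul_right h hT
  have hB : L ≤ (s.filter (fun i => x i ≠ 0)).card := by
    have h : ∑ i ∈ s.filter (fun i => x i ≠ 0), x i ≤ ∑ i ∈ s.filter (fun i => x i ≠ 0), T :=
      sum_le_sum fun i hi => (hx i (mem_filter.1 hi).1).2
    rw [sum_filter_ne_zero, hsum, sum_const, nsmul_eq_mul] at h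
    exact_mod_cast le_of_mul_le_mul_right h hT
  obtain ⟨P, hAP, hPB, hP⟩ := exists_subsuperset_card_eq hAB hA hB
  refine ⟨P, hPB.trans (filter_subset _ _), hP, fun i hi => (mem_filter.1 (hPB hi)).2, ?_⟩
  exact fun i hi hiP h => hiP (hAP (mem_filter.2 ⟨hi, h⟩))

/-- A load vector whose sum is an integer multiple of `T` cannot have exactly one fractional
coordinate. -/
lemma card_fractionalPart_ne_one {ι : Type*} [DecidableEq ι] {s : Finset ι} {L : ℕ} {x : ι → ℝ}
    {T : ℝ} (hT : 0 < T) (hx : ∀ i ∈ s, 0 ≤ x i ∧ x i ≤ T) (hsum : ∑ i ∈ s, x i = L * T) :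
    (fractionalPart s x T).card ≠ 1 := by
  intro h
  obtain ⟨m, hm⟩ := card_eq_one.1 h
  obtain ⟨hms, hm0, hmT⟩ := mem_fractionalPart.1 (hm ▸ mem_singleton_self m)
  have hrest : ∀ i ∈ s.erase m, x i = if x i = T then T else 0 := by
    intro i hi
    obtain ⟨him, his⟩ := mem_erase.1 hi
    split_ifs with hiT
    · exact hiT
    · by_contra hi0
      exact him (mem_singleton.1 (hm ▸ mem_fractionalPart.2 ⟨his, hi0, hiT⟩))
  rw [← add_sum_erase s x hms, sum_congr rfl hrest, ← sum_filter, sum_const, nsmul_eq_mul] at hsum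
  set a := ((s.erase m).filter fun i => x i = T).card
  have hpos : 0 < x m := lt_of_le_of_ne (hx m hms).1 hm0.symm
  have hlt : x m < T := lt_of_le_of_ne (hx m hms).2 hmT
  have h1 : a < L := by
    have : (a : ℝ) * T < L * T := by linarith
    exact_mod_cast lt_of_mul_lt_mul_right this hT.le
  have h2 : L < a + 1 := by
    have : (L : ℝ) * T < (a + 1) * T := by linarith
    exact_mod_cast lt_of_mul_lt_mul_right this hT.le
  omega

/-- One filling step: give weight `a` to a set `P` of size `L` so that the remaining load vector is
still admissible and has fewer fractional coordinates. -/
lemma exists_filling_step {ι : Type*} [DecidableEq ι] {s : Finset ι} {L : ℕ} {x : ι → ℝ}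
    {T : ℝ} (hT : 0 < T) (hx : ∀ i ∈ s, 0 ≤ x i ∧ x i ≤ T) (hsum : ∑ i ∈ s, x i = L * T)
    (hne : (fractionalPart s x T).Nonempty) :
    ∃ P ⊆ s, P.card = L ∧ ∃ a, 0 < a ∧ a < T ∧
      (∀ i ∈ s, 0 ≤ x i - (if i ∈ P then a else 0) ∧
        x i - (if i ∈ P then a else 0) ≤ T - a) ∧
      ∑ i ∈ s, (x i - if i ∈ P then a else 0) = L * (T - a) ∧
      (fractionalPart s (fun i => x i - if i ∈ P then a else 0) (T - a)).card <
        (fractionalPart s x T).card := by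
  obtain ⟨P, hPs, hPL, hP0, hPT⟩ := exists_card_eq_of_sum_eq hT hx hsum
  obtain ⟨m, hm⟩ := hne
  obtain ⟨hms, hm0, hmT⟩ := mem_fractionalPart.1 hm
  obtain ⟨k, hks, hk⟩ := exists_min_image s (fun i => if i ∈ P then x i else T - x i) ⟨m, hms⟩
  obtain ⟨a, ha⟩ : ∃ a, a = if k ∈ P then x k else T - x k := ⟨_, rfl⟩
  simp only [← ha] at hk
  have hapos : 0 < a := by
    rw [ha]
    split_ifs with hkP
    · exact lt_of_le_of_ne (hx k hks).1 (hP0 k hkP).symm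
    · exact sub_pos.2 (lt_of_le_of_ne (hx k hks).2 (hPT k hks hkP))
  have haT : a < T := by
    refine (hk m hms).trans_lt ?_
    split_ifs
    · exact lt_of_le_of_ne (hx m hms).2 hmT
    · exact sub_lt_self T (lt_of_le_of_ne (hx m hms).1 hm0.symm)
  refine ⟨P, hPs, hPL, a, hapos, haT, fun i hi => ?_, ?_, card_lt_card ?_⟩
  · have := hk i hi
    have := hx i hi
    split_ifs at * <;> constructor <;> linarith
  · rw [sum_sub_distrib, hsum, sum_ite_mem, inter_eq_right.2 hPs, sum_const, hPL, nsmul_eq_mul]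
    ring
  · refine (ssubset_iff_of_subset fun i hi => ?_).2 ⟨k, ?_, ?_⟩
    · rw [mem_fractionalPart] at hi ⊢
      obtain ⟨his, hi0, hiT⟩ := hi
      by_cases hiP : i ∈ P
      · simp only [hiP, if_true] at hi0 hiT
        exact ⟨his, hP0 i hiP, fun h => hiT (by rw [h])⟩
      · simp only [hiP, if_false, sub_zero] at hi0 hiT
        exact ⟨his, hi0, hPT i his hiP⟩
    · refine mem_fractionalPart.2 ⟨hks, ?_⟩
      by_cases hkP : k ∈ P
      · simp only [hkP, if_true] at ha
        exact ⟨hP0 k hkP, by linarith⟩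
      · simp only [hkP, if_false] at ha
        exact ⟨fun h => by linarith, hPT k hks hkP⟩
    · rw [mem_fractionalPart]
      rintro ⟨-, h0, h1⟩
      by_cases hkP : k ∈ P
      · simp only [hkP, if_true] at ha h0
        exact h0 (by linarith)
      · simp only [hkP, if_false] at ha h1
        exact h1 (by linarith)

/-- A load vector bounded by `T` with sum `L * T` is a positive combination, of total weight `T`,
of indicators of `L`-element sets; the number of sets is at most the number of fractional
coordinates, unless there are none, when one set suffices. -/
lemma exists_filling {ι : Type*} [DecidableEq ι] {s : Finset ι} {L : ℕ} {x : ι → ℝ}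
    {T : ℝ} (hT : 0 < T) (hx : ∀ i ∈ s, 0 ≤ x i ∧ x i ≤ T) (hsum : ∑ i ∈ s, x i = L * T) :
    ∃ (F : ℕ) (α : ℕ → ℝ) (P : ℕ → Finset ι),
      1 ≤ F ∧ F ≤ max 1 (fractionalPart s x T).card ∧ (∀ f, 0 < α f) ∧
      ∑ f ∈ range F, α f = T ∧ (∀ f, P f ⊆ s ∧ (P f).card = L) ∧
      ∀ i ∈ s, ∑ f ∈ range F, (if i ∈ P f then α f else 0) = x i := by
  induction hk : (fractionalPart s x T).card using Nat.strong_induction_on generalizing x T with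
  | _ k ih =>
  obtain h | hne := (fractionalPart s x T).eq_empty_or_nonempty
  · obtain ⟨P, hPs, hPL, hP0, hPT⟩ := exists_card_eq_of_sum_eq hT hx hsum
    refine ⟨1, fun _ => T, fun _ => P, le_rfl, le_max_left _ _, fun _ => hT, by simp,
      fun _ => ⟨hPs, hPL⟩, fun i hi => ?_⟩
    have hi' : ¬ (x i ≠ 0 ∧ x i ≠ T) := fun hi' =>
      notMem_empty i (h ▸ mem_fractionalPart.2 ⟨hi, hi'⟩)
    rw [sum_range_one]
    split_ifs with hiP
    · by_contra hiT
      exact hi' ⟨hP0 i hiP, Ne.symm hiT⟩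
    · by_contra hi0
      exact hi' ⟨Ne.symm hi0, hPT i hi hiP⟩
  · obtain ⟨P, hPs, hPL, a, ha, haT, hx', hsum', hlt⟩ := exists_filling_step hT hx hsum hne
    obtain ⟨F, β, Q, hF1, hF, hβ, hβsum, hQ, hQsum⟩ :=
      ih _ (hk ▸ hlt) (sub_pos.2 haT) hx' hsum' rfl
    have hk1 := card_fractionalPart_ne_one hT hx hsum
    have hk0 := hne.card_pos
    refine ⟨F + 1, fun f => Nat.casesOn f a β, fun f => Nat.casesOn f P Q, by omega, by omega,
      ?_, ?_, ?_, fun i hi => ?_⟩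
    · rintro (_ | f)
      exacts [ha, hβ f]
    · simp [sum_range_succ', hβsum]
    · rintro (_ | f)
      exacts [⟨hPs, hPL⟩, hQ f]
    · simp [sum_range_succ', hQsum i hi]

/-- Existence of a computation assignment realizing a
computation load vector (filling problem, sufficiency with at most `N`
parts): if `0 ≤ μ[n] ≤ 1` for all `n ∈ [N]` and `Σ_{n=1}^N μ[n] = L`, then
there exist `F` with `1 ≤ F ≤ N`, positive reals `α_1, …, α_F` summing to
`1`, and subsets `P_1, …, P_F ⊆ [N]` each of cardinality `L`, such that
for every `n ∈ [N]`, `Σ_{f : n ∈ P_f} α_f = μ[n]`. -/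
theorem stmt_12 (N L : ℕ) (hL : 1 ≤ L) (hLN : L ≤ N) (μ : ℕ → ℝ)
    (hμ01 : ∀ n ∈ Icc 1 N, 0 ≤ μ n ∧ μ n ≤ 1)
    (hμsum : (∑ n ∈ Icc 1 N, μ n) = L) :
    ∃ (F : ℕ) (α : ℕ → ℝ) (P : ℕ → Finset ℕ),
      1 ≤ F ∧ F ≤ N ∧
      (∀ f ∈ Icc 1 F, 0 < α f) ∧
      (∑ f ∈ Icc 1 F, α f) = 1 ∧
      (∀ f ∈ Icc 1 F, P f ⊆ Icc 1 N ∧ (P f).card = L) ∧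
      (∀ n ∈ Icc 1 N, (∑ f ∈ (Icc 1 F).filter (fun f => n ∈ P f), α f) = μ n) := by
  obtain ⟨F, α, P, hF1, hF, hα, hαsum, hP, hPsum⟩ :=
    exists_filling one_pos hμ01 (by rw [hμsum, mul_one])
  have hcard : (fractionalPart (Icc 1 N) μ 1).card ≤ N := by
    simpa using card_le_card (fun i hi => (mem_fractionalPart.1 hi).1 :
      fractionalPart (Icc 1 N) μ 1 ⊆ Icc 1 N)
  have hshift (g : ℕ → ℝ) : ∑ f ∈ Icc 1 F, g (f - 1) = ∑ f ∈ range F, g f := by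
    rw [← Ico_add_one_right_eq_Icc, sum_Ico_eq_sum_range]
    simp
  refine ⟨F, fun f => α (f - 1), fun f => P (f - 1), hF1, by omega, fun f _ => hα _,
    (hshift α).trans hαsum, fun f _ => hP _, fun n hn => ?_⟩
  rw [sum_filter, ← hPsum n hn]
  exact hshift fun f => if n ∈ P f then α f else 0
end
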